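/- arXiv:2306.01882 — 4 statements merged into one kernel-verified Lean document; each statement's English description precedes it below -/
import Mathlib

section
/- The dual eigenvalues of the non-binary Johnson scheme satisfy the first recurrence relation: for integers r ≥ 3 and 1 ≤ k ≤ n−1, for all natural numbers i, j with i + j ≤ k and i + 1 ≤ k, all natural numbers y with y ≤ k−i−1 and y ≤ n−k, and all x ∈ ℚ, provided n−i−2j ≠ 0 and n−i−2j+2 ≠ 0, one has θ*(x,y)·q_{ij}(x,y) = (n(r−3)i/k)·q_{ij}(x,y) + (n(i+1)(k−i−j)/(k(n−i−2j)))·q_{i+1,j}(x,y) + (n(i+1)(n−k−j+1)/(k(n−i−2j+2)))·q_{i+1,j−1}(x,y) + (n(n−j−k)(j+1)(r−2)/(k(n−i−2j)))·q_{i−1,j+1}(x,y) + (n(k−i−j+1)(n−i−j+2)(r−2)/(k(n−i−2j+2)))·q_{i−1,j}(x,y), where θ*(x,y) = (n/k)((r−2)(k−y) − x(r−1)). -/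
/-- Generalized binomial coefficient `C(z, l) = z (z-1) ⋯ (z-l+1) / l!` for `z : ℚ`. -/
noncomputable def qchoose (z : ℚ) (l : ℕ) : ℚ :=
  (∏ m ∈ Finset.range l, (z - m)) / (Nat.factorial l : ℚ)

/-- Krawtchouk polynomial `K_i(x, N, p)`. -/
noncomputable def Kraw (i : ℕ) (x N p : ℚ) : ℚ :=
  ∑ l ∈ Finset.range (i + 1),
    (-1 : ℚ) ^ l * (p - 1) ^ (i - l) * qchoose x l * qchoose (N - x) (i - l)

/-- Eberlein polynomial `E_i(x, N, p)`. -/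
noncomputable def Eber (i : ℕ) (x N p : ℚ) : ℚ :=
  ∑ l ∈ Finset.range (i + 1),
    (-1 : ℚ) ^ l * qchoose x l * qchoose (p - x) (i - l) * qchoose (N - p - x) (i - l)

/-- Hahn polynomial `H_i(x, N, p) = ((C(N,i) - C(N,i-1)) / (C(p,x) C(N-p,x))) E_x(i, N, p)`,
with the convention `C(N, -1) = 0`. -/
noncomputable def Hahn (i x : ℕ) (N p : ℚ) : ℚ :=
  ((qchoose N i - if i = 0 then 0 else qchoose N (i - 1)) / (qchoose p x * qchoose (N - p) x))
    * Eber x (i : ℚ) N p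

/-- Krawtchouk polynomial with an integer index, with the convention `K_{-1} := 0`. -/
noncomputable def KrawZ (i : ℤ) (x N p : ℚ) : ℚ :=
  if i < 0 then 0 else Kraw i.toNat x N p

/-- Hahn polynomial with an integer index, with the convention `H_{-1} := 0`. -/
noncomputable def HahnZ (i : ℤ) (x : ℕ) (N p : ℚ) : ℚ :=
  if i < 0 then 0 else Hahn i.toNat x N p

/-- Dual eigenvalues `q_{ij}(x, y)` of the non-binary Johnson scheme `J_r(k, n)`,
with the convention `q_{ij} := 0` if `i < 0` or `j < 0`. -/
noncomputable def qdual (r n k : ℤ) (i j : ℤ) (x : ℚ) (y : ℕ) : ℚ :=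
  if i < 0 ∨ j < 0 then 0 else
    (qchoose (n : ℚ) i.toNat / qchoose (k : ℚ) i.toNat)
      * Kraw i.toNat x ((k : ℚ) - y) ((r : ℚ) - 1)
      * Hahn j.toNat y ((n : ℚ) - (i : ℚ)) ((k : ℚ) - (i : ℚ))

theorem qchoose_zero (z : ℚ) : qchoose z 0 = 1 := by simp [qchoose]

theorem succ_mul_qchoose_succ (z : ℚ) (l : ℕ) :
    ((l : ℚ) + 1) * qchoose z (l + 1) = (z - l) * qchoose z l := by
  have h : (Nat.factorial l : ℚ) ≠ 0 := by exact_mod_cast Nat.factorial_ne_zero l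
  have h' : (l : ℚ) + 1 ≠ 0 := by positivity
  simp only [qchoose, Finset.prod_range_succ, Nat.factorial_succ]
  push_cast
  field_simp

theorem succ_mul_qchoose_add_one_succ (z : ℚ) (l : ℕ) :
    ((l : ℚ) + 1) * qchoose (z + 1) (l + 1) = (z + 1) * qchoose z l := by
  have h : (Nat.factorial l : ℚ) ≠ 0 := by exact_mod_cast Nat.factorial_ne_zero l
  have h' : (l : ℚ) + 1 ≠ 0 := by positivity
  simp only [qchoose, Finset.prod_range_succ', Nat.factorial_succ]
  push_cast
  simp only [add_sub_add_right_eq_sub, sub_zero]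
  field_simp

theorem sub_mul_qchoose_add_one (z : ℚ) (l : ℕ) :
    (z + 1 - l) * qchoose (z + 1) l = (z + 1) * qchoose z l := by
  rw [← succ_mul_qchoose_succ, succ_mul_qchoose_add_one_succ]

theorem qchoose_add_one_succ (z : ℚ) (l : ℕ) :
    qchoose (z + 1) (l + 1) = qchoose z (l + 1) + qchoose z l := by
  have h' : (l : ℚ) + 1 ≠ 0 := by positivity
  apply mul_left_cancel₀ h'
  linear_combination succ_mul_qchoose_add_one_succ z l - succ_mul_qchoose_succ z l

theorem qchoose_pos {z : ℚ} {l : ℕ} (h : (l : ℚ) - 1 < z) : 0 < qchoose z l := by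
  unfold qchoose
  refine div_pos (Finset.prod_pos fun m hm => ?_) (by exact_mod_cast Nat.factorial_pos l)
  have : (m : ℚ) + 1 ≤ l := by exact_mod_cast Finset.mem_range.mp hm
  linarith

/-- A sum of two sequences that cancel after a shift vanishes. -/
theorem sum_range_add_eq_zero (f g : ℕ → ℚ) (y : ℕ) (hf : f 0 = 0) (hg : g y = 0)
    (h : ∀ l < y, f (l + 1) + g l = 0) : ∑ l ∈ Finset.range (y + 1), (f l + g l) = 0 := by
  rw [Finset.sum_add_distrib, Finset.sum_range_succ', Finset.sum_range_succ g, hf, hg, add_zero,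
    add_zero, ← Finset.sum_add_distrib]
  exact Finset.sum_eq_zero fun l hl => h l (Finset.mem_range.mp hl)

/-- The hypergeometric sum underlying the Eberlein polynomials. -/
noncomputable def eberSum (y : ℕ) (j a b : ℚ) : ℚ :=
  ∑ l ∈ Finset.range (y + 1),
    (-1 : ℚ) ^ l * qchoose j l * qchoose a (y - l) * qchoose b (y - l)

theorem eberSum_up (y : ℕ) (j a b : ℚ) :
    (a + b + 2) * eberSum y j a (b + 1)
      = (b + 1) * eberSum y (j + 1) a b + (a + 1) * eberSum y j (a + 1) (b + 1) := by
  rw [← sub_eq_zero]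
  simp only [eberSum, Finset.mul_sum]
  rw [← Finset.sum_add_distrib, ← Finset.sum_sub_distrib]
  let f : ℕ → ℚ := fun l => (-1 : ℚ) ^ l * (qchoose j l - qchoose (j + 1) l) *
    qchoose a (y - l) * ((b + 1) * qchoose b (y - l))
  let g : ℕ → ℚ := fun l => (-1 : ℚ) ^ l * qchoose j l * qchoose (b + 1) (y - l) *
    ((a + 1 + (y - l : ℕ)) * qchoose a (y - l) - (a + 1) * qchoose (a + 1) (y - l))
  rw [← sum_range_add_eq_zero f g y (by simp [f, qchoose_zero]) (by simp [g, qchoose_zero])]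
  · refine Finset.sum_congr rfl fun l _ => ?_
    simp only [f, g]
    linear_combination (-1 : ℚ) ^ l * qchoose j l * qchoose a (y - l) *
      sub_mul_qchoose_add_one b (y - l)
  · intro l hl
    obtain ⟨m, rfl⟩ : ∃ m, y = l + 1 + m := ⟨y - (l + 1), by omega⟩
    have e : l + 1 + m - l = m + 1 := by omega
    simp only [f, g, Nat.add_sub_cancel_left, e, qchoose_add_one_succ j l]
    push_cast
    rw [pow_succ, ← succ_mul_qchoose_add_one_succ b m]
    linear_combination (-1 : ℚ) ^ l * qchoose j l * qchoose (b + 1) (m + 1) *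
      (succ_mul_qchoose_succ a m - (a + 1) * qchoose_add_one_succ a m)

theorem eberSum_down (y : ℕ) (j a b : ℚ) :
    (a + b + 2) * (a + 1 + j + 1 - y) * eberSum y (j + 1) (a + 1) b
      = (a + b + j + 3) * (a + 1) * eberSum y (j + 1) a b
        + (j + 1) * (b + 1) * eberSum y j (a + 1) (b + 1) := by
  rw [← sub_eq_zero]
  simp only [eberSum, Finset.mul_sum]
  rw [← Finset.sum_add_distrib, ← Finset.sum_sub_distrib]
  let f : ℕ → ℚ := fun l => (-1 : ℚ) ^ l * (-(l * qchoose (j + 1) l)) *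
    ((a + 1 - (y - l : ℕ)) * qchoose (a + 1) (y - l)) * qchoose b (y - l)
  let g : ℕ → ℚ := fun l => (-1 : ℚ) ^ l * ((j + 1 - l) * qchoose (j + 1) l) *
    qchoose (a + 1) (y - l) *
    ((b + 1 + (y - l : ℕ)) * qchoose b (y - l) - (b + 1) * qchoose (b + 1) (y - l))
  rw [← sum_range_add_eq_zero f g y (by simp [f]) (by simp [g, qchoose_zero])]
  · refine Finset.sum_congr rfl fun l hl => ?_
    obtain ⟨m, rfl⟩ : ∃ m, y = l + m :=
      ⟨y - l, by have := Finset.mem_range.mp hl; omega⟩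
    simp only [f, g, Nat.add_sub_cancel_left]
    push_cast
    linear_combination (-1 : ℚ) ^ l * (a + b + j + 3) * qchoose (j + 1) l * qchoose b m *
        sub_mul_qchoose_add_one a m +
      (-1 : ℚ) ^ l * (b + 1) * qchoose (a + 1) m * qchoose (b + 1) m *
        sub_mul_qchoose_add_one j l
  · intro l hl
    obtain ⟨m, rfl⟩ : ∃ m, y = l + 1 + m := ⟨y - (l + 1), by omega⟩
    have e : l + 1 + m - l = m + 1 := by omega
    simp only [f, g, Nat.add_sub_cancel_left, e]
    rw [← succ_mul_qchoose_succ (a + 1) m, ← succ_mul_qchoose_succ (j + 1) l]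
    push_cast
    linear_combination (-1 : ℚ) ^ l * ((l : ℚ) + 1) * qchoose (j + 1) (l + 1) *
      qchoose (a + 1) (m + 1) *
      (succ_mul_qchoose_succ b m - (b + 1) * qchoose_add_one_succ b m)

theorem eber_eq_eberSum (y : ℕ) (j N P : ℚ) :
    Eber y j N P = eberSum y j (P - j) (N - P - j) := rfl

/-- Closed form of the difference `C(N, j) - C(N, j - 1)`. -/
theorem sub_qchoose_pred_mul (N : ℚ) (j : ℕ) :
    (qchoose N j - if j = 0 then 0 else qchoose N (j - 1)) * (N - j + 1)
      = qchoose N j * (N - 2 * j + 1) := by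
  cases j with
  | zero => simp
  | succ j =>
    simp only [Nat.succ_ne_zero, if_false, Nat.add_sub_cancel]
    push_cast
    linear_combination succ_mul_qchoose_succ N j

/-- Closed form of the Hahn polynomial. -/
theorem hahn_eq (j y : ℕ) {N : ℚ} (P : ℚ) (hN : N - j + 1 ≠ 0) :
    Hahn j y N P = qchoose N j * (N - 2 * j + 1) / (N - j + 1)
      / (qchoose P y * qchoose (N - P) y) * eberSum y j (P - j) (N - P - j) := by
  rw [← sub_qchoose_pred_mul, mul_div_assoc, div_self hN, mul_one]
  rfl

theorem hahn_down_zero (y : ℕ) {N P : ℚ} (hN : 0 < N) (hP : (y : ℚ) < P) (hM : (y : ℚ) ≤ N - P) :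
    P * Hahn 0 y N P = N * (P / N * Hahn 0 y (N - 1) (P - 1)) := by
  have h1 : 0 < qchoose P y := qchoose_pos (by linarith)
  have h2 : 0 < qchoose (P - 1) y := qchoose_pos (by linarith)
  have h3 : 0 < qchoose (N - P) y := qchoose_pos (by linarith)
  have e : N - 1 - (P - 1) = N - P := by ring
  have hz (M Q : ℚ) : Eber y ((0 : ℕ) : ℚ) M Q = qchoose Q y * qchoose (M - Q) y := by
    rw [eber_eq_eberSum, eberSum, Finset.sum_range_succ', Finset.sum_eq_zero]
    · simp [qchoose_zero]
    · intro l _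
      simp [qchoose, Finset.prod_range_succ']
  simp only [Hahn, hz, e, qchoose_zero, if_true]
  field_simp

theorem hahn_down_succ (j y : ℕ) {N P : ℚ} (hP : (y : ℚ) < P) (hM : (y : ℚ) ≤ N - P)
    (hPN : P < N) (hjP : (j : ℚ) + 1 ≤ P) (h1 : N - 2 * (j + 1) ≠ 0) (h2 : N - 2 * (j + 1) + 2 ≠ 0) :
    P * Hahn (j + 1) y N P = N * ((P - (j + 1)) / (N - 2 * (j + 1)) * Hahn (j + 1) y (N - 1) (P - 1)
      + (N - P - (j + 1) + 1) / (N - 2 * (j + 1) + 2) * Hahn j y (N - 1) (P - 1)) := by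
  have hy : (0 : ℚ) ≤ y := by positivity
  have hj : (0 : ℚ) ≤ j := by positivity
  have hc1 := (qchoose_pos (z := P) (l := y) (by linarith)).ne'
  have hc3 := (qchoose_pos (z := N - P) (l := y) (by linarith)).ne'
  have e : N - 1 - (P - 1) = N - P := by ring
  have hE := eberSum_down y j (P - (j + 1) - 1) (N - P - (j + 1))
  have n1 : N - (j + 1) ≠ 0 := by linarith
  have n2 : N - (j + 1) + 1 ≠ 0 := by linarith
  have n3 : P ≠ 0 := by linarith
  have n4 : N ≠ 0 := by linarith
  have n5 : P - y ≠ 0 := by linarith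
  have c1 : qchoose (N - 1) (j + 1) = (N - (j + 1)) / N * qchoose N (j + 1) := by
    have h := sub_mul_qchoose_add_one (N - 1) (j + 1)
    push_cast at h
    simp only [sub_add_cancel] at h
    field_simp
    linarith
  have c2 : qchoose (N - 1) j = (j + 1) / N * qchoose N (j + 1) := by
    have h := succ_mul_qchoose_add_one_succ (N - 1) j
    simp only [sub_add_cancel] at h
    field_simp
    linarith
  have c3 : qchoose (P - 1) y = (P - y) / P * qchoose P y := by
    have h := sub_mul_qchoose_add_one (P - 1) y
    simp only [sub_add_cancel] at h
    field_simp
    linarith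
  rw [hahn_eq (j + 1) y P (by push_cast; linarith),
    hahn_eq (j + 1) y (P - 1) (by push_cast; contrapose! n1; linarith),
    hahn_eq j y (P - 1) (by contrapose! n1; linarith), e, c1, c2, c3]
  push_cast
  rw [show P - 1 - ((j : ℚ) + 1) = P - (j + 1) - 1 by ring,
    show P - 1 - (j : ℚ) = P - (j + 1) - 1 + 1 by ring,
    show N - P - (j : ℚ) = N - P - (j + 1) + 1 by ring,
    show N - 1 - 2 * ((j : ℚ) + 1) + 1 = N - 2 * (j + 1) by ring,
    show N - 1 - 2 * (j : ℚ) + 1 = N - 2 * (j + 1) + 2 by ring,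
    show N - 1 - ((j : ℚ) + 1) + 1 = N - (j + 1) by ring,
    show N - 1 - (j : ℚ) + 1 = N - (j + 1) + 1 by ring]
  rw [show P - (j + 1) - 1 + 1 = P - ((j : ℚ) + 1) by ring] at hE ⊢
  field_simp
  linear_combination qchoose N (j + 1) * hE

theorem hahn_up (j y : ℕ) {N P : ℚ} (hP : (y : ℚ) ≤ P) (hM : (y : ℚ) ≤ N - P)
    (hjP : (j : ℚ) ≤ P) (h1 : N - 2 * j ≠ 0) (h2 : N - 2 * j + 2 ≠ 0) :
    (N + 1) * (P - y + 1) * Hahn j y N P = (P + 1) *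
      ((N - P - j) * (j + 1) / (N - 2 * j) * Hahn (j + 1) y (N + 1) (P + 1)
        + (P - j + 1) * (N - j + 2) / (N - 2 * j + 2) * Hahn j y (N + 1) (P + 1)) := by
  have hy : (0 : ℚ) ≤ y := by positivity
  have hj : (0 : ℚ) ≤ j := by positivity
  have hc1 := (qchoose_pos (z := P) (l := y) (by linarith)).ne'
  have hc3 := (qchoose_pos (z := N - P) (l := y) (by linarith)).ne'
  have hE := eberSum_up y j (P - j) (N - P - (j + 1))
  have n1 : N - j + 1 ≠ 0 := by linarith
  have n2 : N - j + 2 ≠ 0 := by linarith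
  have n3 : P + 1 ≠ 0 := by linarith
  have n4 : N + 1 ≠ 0 := by linarith
  have n5 : P - y + 1 ≠ 0 := by linarith
  have n6 : (j : ℚ) + 1 ≠ 0 := by linarith
  have c1 : qchoose (N + 1) j = (N + 1) / (N - j + 1) * qchoose N j := by
    field_simp
    linarith [sub_mul_qchoose_add_one N j]
  have c2 : qchoose (N + 1) (j + 1) = (N + 1) / (j + 1) * qchoose N j := by
    field_simp
    linarith [succ_mul_qchoose_add_one_succ N j]
  have c3 : qchoose (P + 1) y = (P + 1) / (P - y + 1) * qchoose P y := by
    field_simp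
    linarith [sub_mul_qchoose_add_one P y]
  rw [hahn_eq j y P n1, hahn_eq j y (P + 1) (by contrapose! n2; linarith),
    hahn_eq (j + 1) y (P + 1) (by push_cast; contrapose! n1; linarith),
    show N + 1 - (P + 1) = N - P by ring, c1, c2, c3]
  push_cast
  rw [show N - P - (j : ℚ) = N - P - (j + 1) + 1 by ring,
    show P + 1 - ((j : ℚ) + 1) = P - j by ring,
    show P + 1 - (j : ℚ) = P - j + 1 by ring,
    show N + 1 - 2 * ((j : ℚ) + 1) + 1 = N - 2 * j by ring,
    show N + 1 - 2 * (j : ℚ) + 1 = N - 2 * j + 2 by ring,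
    show N + 1 - ((j : ℚ) + 1) + 1 = N - j + 1 by ring,
    show N + 1 - (j : ℚ) + 1 = N - j + 2 by ring]
  field_simp
  linear_combination qchoose N j * hE

theorem sum_range_mul_left (v u : ℕ → ℚ) (i : ℕ) :
    ∑ l ∈ Finset.range (i + 2), (l : ℚ) * (v l * u (i + 1 - l))
      = ∑ l ∈ Finset.range (i + 1), ((l : ℚ) + 1) * v (l + 1) * u (i - l) := by
  rw [Finset.sum_range_succ']
  simp [mul_assoc]

theorem sum_range_mul_right (v u : ℕ → ℚ) (i : ℕ) :
    ∑ l ∈ Finset.range (i + 2), ((i + 1 - l : ℕ) : ℚ) * (v l * u (i + 1 - l))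
      = ∑ l ∈ Finset.range (i + 1), v l * ((((i - l : ℕ) : ℚ) + 1) * u (i - l + 1)) := by
  rw [Finset.sum_range_succ]
  simp only [Nat.sub_self, Nat.cast_zero, zero_mul, add_zero]
  refine Finset.sum_congr rfl fun l hl => ?_
  have e : i + 1 - l = i - l + 1 := by have := Finset.mem_range.mp hl; omega
  rw [e]
  push_cast
  ring

theorem kraw_eq (i : ℕ) (x N p : ℚ) : Kraw i x N p = ∑ l ∈ Finset.range (i + 1),
    ((-1 : ℚ) ^ l * qchoose x l) * ((p - 1) ^ (i - l) * qchoose (N - x) (i - l)) :=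
  Finset.sum_congr rfl fun l _ => by ring

theorem succ_mul_kraw_succ (i : ℕ) (x N p : ℚ) :
    ((i : ℚ) + 1) * Kraw (i + 1) x N p = ∑ l ∈ Finset.range (i + 1),
      (-(x - l) + (p - 1) * (N - x - (i - l : ℕ))) * (((-1 : ℚ) ^ l * qchoose x l) *
        ((p - 1) ^ (i - l) * qchoose (N - x) (i - l))) := by
  have hL := sum_range_mul_left (fun l => (-1 : ℚ) ^ l * qchoose x l)
    (fun m => (p - 1) ^ m * qchoose (N - x) m) i
  have hR := sum_range_mul_right (fun l => (-1 : ℚ) ^ l * qchoose x l)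
    (fun m => (p - 1) ^ m * qchoose (N - x) m) i
  have hS := congrArg₂ (· + ·) hL hR
  simp only [← Finset.sum_add_distrib, ← add_mul] at hS
  rw [kraw_eq, Finset.mul_sum]
  refine Eq.trans (Finset.sum_congr rfl fun l hl => ?_)
    (hS.trans (Finset.sum_congr rfl fun l _ => ?_))
  · have : l ≤ i + 1 := by have := Finset.mem_range.mp hl; omega
    push_cast [Nat.cast_sub this]
    ring
  · rw [pow_succ, pow_succ]
    linear_combination
      -(-1 : ℚ) ^ l * ((p - 1) ^ (i - l) * qchoose (N - x) (i - l)) * succ_mul_qchoose_succ x l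
      + (-1 : ℚ) ^ l * qchoose x l * (p - 1) ^ (i - l) * (p - 1) *
        succ_mul_qchoose_succ (N - x) (i - l)

theorem kraw_recurrence_zero (x N p : ℚ) :
    ((p - 1) * N - p * x) * Kraw 0 x N p = Kraw 1 x N p := by
  simp [Kraw, qchoose, Finset.sum_range_succ]
  ring

theorem sum_range_mul_left_add_mul_right (c : ℕ → ℚ) (i : ℕ) :
    ∑ l ∈ Finset.range (i + 1), (l : ℚ) * c l
      + ∑ l ∈ Finset.range (i + 1), ((i - l : ℕ) : ℚ) * c l
      = i * ∑ l ∈ Finset.range (i + 1), c l := by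
  rw [← Finset.sum_add_distrib, Finset.mul_sum]
  refine Finset.sum_congr rfl fun l hl => ?_
  have : l ≤ i := by have := Finset.mem_range.mp hl; omega
  push_cast [Nat.cast_sub this]
  ring

theorem kraw_recurrence_succ (i : ℕ) (x N p : ℚ) :
    ((p - 1) * N - p * x) * Kraw (i + 1) x N p
      = ((i : ℚ) + 2) * Kraw (i + 2) x N p + (p - 2) * ((i : ℚ) + 1) * Kraw (i + 1) x N p
        + (p - 1) * (N - i) * Kraw i x N p := by
  let v : ℕ → ℚ := fun l => (-1 : ℚ) ^ l * qchoose x l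
  let u : ℕ → ℚ := fun m => (p - 1) ^ m * qchoose (N - x) m
  have hv (l : ℕ) : ((l : ℚ) + 1) * v (l + 1) = -(x - l) * v l := by
    simp only [v, pow_succ]
    linear_combination -(-1 : ℚ) ^ l * succ_mul_qchoose_succ x l
  have hu (m : ℕ) : ((m : ℚ) + 1) * u (m + 1) = (p - 1) * (N - x - m) * u m := by
    simp only [u, pow_succ]
    linear_combination (p - 1) ^ m * (p - 1) * succ_mul_qchoose_succ (N - x) m
  have hK (i : ℕ) : Kraw i x N p = ∑ l ∈ Finset.range (i + 1), v l * u (i - l) := kraw_eq i x N p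
  have h : ((i : ℚ) + 2) * Kraw (i + 2) x N p
      = (-x + (p - 1) * (N - x)) * Kraw (i + 1) x N p
        + ∑ l ∈ Finset.range (i + 2), (l : ℚ) * (v l * u (i + 1 - l))
        - (p - 1) * ∑ l ∈ Finset.range (i + 2), ((i + 1 - l : ℕ) : ℚ) * (v l * u (i + 1 - l)) := by
    have h := succ_mul_kraw_succ (i + 1) x N p
    rw [hK (i + 1), Finset.mul_sum, Finset.mul_sum, ← Finset.sum_add_distrib,
      ← Finset.sum_sub_distrib]
    push_cast at h
    rw [show (i : ℚ) + 2 = i + 1 + 1 by ring, h]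
    exact Finset.sum_congr rfl fun l _ => by simp only [v, u]; ring
  have hL : ∑ l ∈ Finset.range (i + 2), (l : ℚ) * (v l * u (i + 1 - l))
      = -x * Kraw i x N p + ∑ l ∈ Finset.range (i + 1), (l : ℚ) * (v l * u (i - l)) := by
    rw [sum_range_mul_left, hK, Finset.mul_sum, ← Finset.sum_add_distrib]
    exact Finset.sum_congr rfl fun l _ => by rw [hv]; ring
  have hR : ∑ l ∈ Finset.range (i + 2), ((i + 1 - l : ℕ) : ℚ) * (v l * u (i + 1 - l))
      = (p - 1) * ((N - x) * Kraw i x N p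
        - ∑ l ∈ Finset.range (i + 1), ((i - l : ℕ) : ℚ) * (v l * u (i - l))) := by
    rw [sum_range_mul_right, hK, Finset.mul_sum, ← Finset.sum_sub_distrib, Finset.mul_sum]
    exact Finset.sum_congr rfl fun l _ => by rw [hu]; ring
  have h1 := sum_range_mul_left_add_mul_right (fun l => v l * u (i + 1 - l)) (i + 1)
  have h0 := sum_range_mul_left_add_mul_right (fun l => v l * u (i - l)) i
  rw [← hK] at h1 h0
  push_cast at h1
  linear_combination -h + (p - 2) * h1 - (p - 1) * hL + hR - (p - 1) * h0

theorem qdual_nat (r n k : ℤ) (i j : ℕ) (x : ℚ) (y : ℕ) :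
    qdual r n k i j x y = (qchoose (n : ℚ) i / qchoose (k : ℚ) i)
      * Kraw i x ((k : ℚ) - y) ((r : ℚ) - 1) * Hahn j y ((n : ℚ) - i) ((k : ℚ) - i) := by
  have h : ¬((i : ℤ) < 0 ∨ (j : ℤ) < 0) := by omega
  simp only [qdual, if_neg h, Int.toNat_natCast, Int.cast_natCast]

theorem qdual_neg_left (r n k : ℤ) {i : ℤ} (j : ℤ) (x : ℚ) (y : ℕ) (hi : i < 0) :
    qdual r n k i j x y = 0 := if_pos (Or.inl hi)

theorem qdual_neg_right (r n k : ℤ) (i : ℤ) {j : ℤ} (x : ℚ) (y : ℕ) (hj : j < 0) :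
    qdual r n k i j x y = 0 := if_pos (Or.inr hj)

theorem qchoose_ratio_succ (n k : ℚ) (i : ℕ) (hk : (i : ℚ) < k) :
    qchoose n (i + 1) / qchoose k (i + 1) = (n - i) / (k - i) * (qchoose n i / qchoose k i) := by
  have h1 := (qchoose_pos (z := k) (l := i) (by linarith)).ne'
  have h2 := (qchoose_pos (z := k) (l := i + 1) (by push_cast; linarith)).ne'
  have h3 : k - i ≠ 0 := by linarith
  have h4 : (i : ℚ) + 1 ≠ 0 := by positivity
  rw [div_mul_div_comm, div_eq_div_iff h2 (mul_ne_zero h3 h1), ← succ_mul_qchoose_succ,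
    ← succ_mul_qchoose_succ]
  ring

/-- The part of the recurrence raising `i`. -/
theorem qdual_raise (r n k : ℤ) (i j y : ℕ) (x : ℚ) (hkn : k ≤ n - 1) (hij : (i : ℤ) + j ≤ k)
    (hy1 : (y : ℤ) ≤ k - i - 1) (hy2 : (y : ℤ) ≤ n - k)
    (hd1 : n - i - 2 * j ≠ 0) (hd2 : n - i - 2 * j + 2 ≠ 0) :
    ((k : ℚ) - i - j) / ((n : ℚ) - i - 2 * j) * qdual r n k ((i : ℤ) + 1) j x y
      + ((n : ℚ) - k - j + 1) / ((n : ℚ) - i - 2 * j + 2)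
        * qdual r n k ((i : ℤ) + 1) ((j : ℤ) - 1) x y
      = (qchoose (n : ℚ) i / qchoose (k : ℚ) i)
        * Kraw (i + 1) x ((k : ℚ) - y) ((r : ℚ) - 1) * Hahn j y ((n : ℚ) - i) ((k : ℚ) - i) := by
  have hkn' : (k : ℚ) ≤ n - 1 := by exact_mod_cast hkn
  have hij' : (i : ℚ) + j ≤ k := by exact_mod_cast hij
  have hy1' : (y : ℚ) ≤ k - i - 1 := by exact_mod_cast hy1
  have hy2' : (y : ℚ) ≤ n - k := by exact_mod_cast hy2
  have hd1' : (n : ℚ) - i - 2 * j ≠ 0 := by exact_mod_cast hd1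
  have hd2' : (n : ℚ) - i - 2 * j + 2 ≠ 0 := by exact_mod_cast hd2
  have hy : (0 : ℚ) ≤ y := by positivity
  have hki : (k : ℚ) - i ≠ 0 := by linarith
  have hr := qchoose_ratio_succ n k i (by linarith)
  have e1 : (n : ℚ) - ((i + 1 : ℕ) : ℚ) = n - i - 1 := by push_cast; ring
  have e2 : (k : ℚ) - ((i + 1 : ℕ) : ℚ) = k - i - 1 := by push_cast; ring
  rw [show (i : ℤ) + 1 = ((i + 1 : ℕ) : ℤ) by push_cast; ring]
  cases j with
  | zero =>
    have hH := hahn_down_zero y (N := (n : ℚ) - i) (P := k - i)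
      (by linarith) (by linarith) (by linarith)
    rw [qdual_neg_right r n k _ (j := ((0 : ℕ) : ℤ) - 1) x y (by simp), qdual_nat, hr, e1, e2]
    rw [mul_comm, ← eq_div_iff hki] at hH
    rw [hH]
    push_cast
    field_simp
    ring
  | succ j =>
    push_cast at hij' hd1' hd2'
    have hH := hahn_down_succ j y (N := (n : ℚ) - i) (P := k - i)
      (by linarith) (by linarith) (by linarith) (by linarith) hd1' hd2'
    rw [mul_comm, ← eq_div_iff hki] at hH
    rw [show ((j + 1 : ℕ) : ℤ) - 1 = (j : ℤ) by push_cast; ring, qdual_nat, qdual_nat, hr, e1, e2,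
      hH]
    push_cast
    ring

/-- The part of the recurrence lowering `i`. -/
theorem qdual_lower (r n k : ℤ) (i j y : ℕ) (x : ℚ) (hij : (i : ℤ) + 1 + j ≤ k)
    (hy1 : (y : ℤ) ≤ k - i - 2) (hy2 : (y : ℤ) ≤ n - k)
    (hd1 : n - (i + 1) - 2 * j ≠ 0) (hd2 : n - (i + 1) - 2 * j + 2 ≠ 0) :
    ((n : ℚ) - j - k) * ((j : ℚ) + 1) / ((n : ℚ) - (i + 1) - 2 * j)
        * qdual r n k i ((j : ℤ) + 1) x y
      + ((k : ℚ) - (i + 1) - j + 1) * ((n : ℚ) - (i + 1) - j + 2)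
        / ((n : ℚ) - (i + 1) - 2 * j + 2) * qdual r n k i j x y
      = (qchoose (n : ℚ) (i + 1) / qchoose (k : ℚ) (i + 1)) * ((k : ℚ) - y - i)
        * Kraw i x ((k : ℚ) - y) ((r : ℚ) - 1)
        * Hahn j y ((n : ℚ) - (i + 1)) ((k : ℚ) - (i + 1)) := by
  have hij' : (i : ℚ) + 1 + j ≤ k := by exact_mod_cast hij
  have hy1' : (y : ℚ) ≤ k - i - 2 := by exact_mod_cast hy1
  have hy2' : (y : ℚ) ≤ n - k := by exact_mod_cast hy2
  have hd1' : (n : ℚ) - (i + 1) - 2 * j ≠ 0 := by exact_mod_cast hd1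
  have hd2' : (n : ℚ) - (i + 1) - 2 * j + 2 ≠ 0 := by exact_mod_cast hd2
  have hy : (0 : ℚ) ≤ y := by positivity
  have hki : (k : ℚ) - i ≠ 0 := by linarith
  have hH := hahn_up j y (N := (n : ℚ) - (i + 1)) (P := k - (i + 1))
    (by linarith) (by linarith) (by linarith) hd1' hd2'
  rw [show (n : ℚ) - (i + 1) + 1 = n - i by ring, show (k : ℚ) - (i + 1) + 1 = k - i by ring,
    show (k : ℚ) - (i + 1) - y + 1 = k - y - i by ring] at hH
  rw [show (j : ℤ) + 1 = ((j + 1 : ℕ) : ℤ) by push_cast; ring, qdual_nat, qdual_nat,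
    qchoose_ratio_succ n k i (by linarith)]
  refine mul_left_cancel₀ hki ?_
  rw [show ((k : ℚ) - i) * ((n - i) / (k - i) * (qchoose n i / qchoose k i) * (k - y - i)
      * Kraw i x (k - y) (r - 1) * Hahn j y (n - (i + 1)) (k - (i + 1)))
      = qchoose n i / qchoose k i * Kraw i x (k - y) (r - 1)
        * ((n - i) * (k - y - i) * Hahn j y (n - (i + 1)) (k - (i + 1))) by field_simp, hH]
  ring

/-- First recurrence relation for the dual eigenvalues of the non-binary Johnson scheme. -/
theorem qdual_first_recurrence (r n k : ℤ) (hr : 3 ≤ r) (hk1 : 1 ≤ k) (hkn : k ≤ n - 1)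
    (i j : ℕ) (hij : (i : ℤ) + j ≤ k) (hi1 : (i : ℤ) + 1 ≤ k)
    (y : ℕ) (hy1 : (y : ℤ) ≤ k - i - 1) (hy2 : (y : ℤ) ≤ n - k)
    (x : ℚ)
    (hd1 : n - i - 2 * j ≠ 0) (hd2 : n - i - 2 * j + 2 ≠ 0) :
    ((n : ℚ) / k * (((r : ℚ) - 2) * ((k : ℚ) - y) - x * ((r : ℚ) - 1))) * qdual r n k i j x y
  = ((n : ℚ) * ((r : ℚ) - 3) * i / k) * qdual r n k i j x y
    + ((n : ℚ) * ((i : ℚ) + 1) * ((k : ℚ) - i - j) / ((k : ℚ) * ((n : ℚ) - i - 2 * j)))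
        * qdual r n k ((i : ℤ) + 1) j x y
    + ((n : ℚ) * ((i : ℚ) + 1) * ((n : ℚ) - k - j + 1) / ((k : ℚ) * ((n : ℚ) - i - 2 * j + 2)))
        * qdual r n k ((i : ℤ) + 1) ((j : ℤ) - 1) x y
    + ((n : ℚ) * ((n : ℚ) - j - k) * ((j : ℚ) + 1) * ((r : ℚ) - 2)
        / ((k : ℚ) * ((n : ℚ) - i - 2 * j)))
        * qdual r n k ((i : ℤ) - 1) ((j : ℤ) + 1) x y
    + ((n : ℚ) * ((k : ℚ) - i - j + 1) * ((n : ℚ) - i - j + 2) * ((r : ℚ) - 2)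
        / ((k : ℚ) * ((n : ℚ) - i - 2 * j + 2)))
        * qdual r n k ((i : ℤ) - 1) j x y := by
  have hk0 : (k : ℚ) ≠ 0 := by
    have : k ≠ 0 := by omega
    exact_mod_cast this
  have hd1' : (n : ℚ) - i - 2 * j ≠ 0 := by exact_mod_cast hd1
  have hd2' : (n : ℚ) - i - 2 * j + 2 ≠ 0 := by exact_mod_cast hd2
  have hR := qdual_raise r n k i j y x hkn hij hy1 hy2 hd1 hd2
  cases i with
  | zero =>
    have hK := kraw_recurrence_zero x (k - y) (r - 1)
    rw [qdual_neg_left r n k (j + 1) x y (i := ((0 : ℕ) : ℤ) - 1) (by simp),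
      qdual_neg_left r n k j x y (i := ((0 : ℕ) : ℤ) - 1) (by simp), qdual_nat]
    push_cast at *
    simp only [div_mul_eq_div_div]
    linear_combination (n : ℚ) / k * (qchoose n 0 / qchoose k 0 * Hahn j y (n - 0) (k - 0) * hK - hR)
  | succ i =>
    have hK := kraw_recurrence_succ i x (k - y) (r - 1)
    have hL := qdual_lower r n k i j y x (by push_cast at hij; exact hij)
      (by push_cast at hy1; linarith) hy2 (by exact_mod_cast hd1) (by exact_mod_cast hd2)
    rw [show ((i + 1 : ℕ) : ℤ) - 1 = i by push_cast; ring, qdual_nat r n k (i + 1) j]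
    push_cast at *
    simp only [div_mul_eq_div_div]
    linear_combination (n : ℚ) / k * (qchoose n (i + 1) / qchoose k (i + 1)
      * Hahn j y (n - (i + 1)) (k - (i + 1)) * hK - (i + 2) * hR - (r - 2) * hL)
end

section
/- The eigenvalues of the non-binary Johnson scheme satisfy the difference relation in the second variable: for integers r ≥ 3 and 1 ≤ k ≤ n−1, for all (i,j) ∈ ℕ² with i+j ≤ k and j ≤ n−k, and all integers x, y ≥ 0 with x+y ≤ k and y ≤ n−k, provided 2y+x−n ∉ {0, 1, 2}, one has j·p_{ij}(x,y) = B·p_{ij}(x,y+1) − (B+D)·p_{ij}(x,y) + D·p_{ij}(x,y−1), where B = (y+x−k)(y+x−n−1)(y+k−n)/((2y+x−n)(2y+x−n−1)) and D = −y(y+x−k−1)(y+k−n−1)/((2y+x−n−1)(2y+x−n−2)). -/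
/-- Eigenvalues `p_{ij}(x, y)` of the non-binary Johnson scheme `J_r(k, n)`,
as a polynomial expression in `(x, y)` evaluated in `ℚ`. -/
noncomputable def peig (r n k : ℤ) (i j : ℕ) (x y : ℚ) : ℚ :=
  ((r : ℚ) - 1) ^ j * Kraw i x ((k : ℚ) - j) ((r : ℚ) - 1) * Eber j y ((n : ℚ) - x) ((k : ℚ) - x)

theorem qchoose_eq_choose (z : ℚ) (l : ℕ) : qchoose z l = Ring.choose z l := by
  have h : ∏ m ∈ Finset.range l, (z - m) = (descPochhammer ℤ l).smeval z := by
    induction l with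
    | zero => simp
    | succ l ih =>
      rw [Finset.prod_range_succ, ih, descPochhammer_succ_right, Polynomial.smeval_mul,
        Polynomial.smeval_sub, Polynomial.smeval_X, Polynomial.smeval_natCast]
      simp
  rw [qchoose, h, Ring.choose_eq_smul, smul_eq_mul, div_eq_inv_mul]

theorem qchoose_succ_mul (z : ℚ) (l : ℕ) :
    qchoose z (l + 1) * (l + 1) = qchoose z l * (z - l) := by
  have h : (l.factorial : ℚ) ≠ 0 := by positivity
  have h' : (l : ℚ) + 1 ≠ 0 := by positivity
  simp only [qchoose, Finset.prod_range_succ, Nat.factorial_succ]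
  push_cast
  field_simp

theorem qchoose_succ_mul' (z : ℚ) (l : ℕ) :
    qchoose z (l + 1) * (l + 1) = z * qchoose (z - 1) l := by
  have h : (l.factorial : ℚ) ≠ 0 := by positivity
  have h' : (l : ℚ) + 1 ≠ 0 := by positivity
  have hp : ∏ m ∈ Finset.range l, (z - ((m + 1 : ℕ) : ℚ)) = ∏ m ∈ Finset.range l, (z - 1 - m) :=
    Finset.prod_congr rfl fun m _ => by push_cast; ring
  simp only [qchoose, Finset.prod_range_succ', Nat.factorial_succ, hp]
  push_cast
  field_simp
  ring

/-- The Chu–Vandermonde identity. -/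
theorem qchoose_add (r s : ℚ) (k : ℕ) :
    qchoose (r + s) k = ∑ l ∈ Finset.range (k + 1), qchoose r l * qchoose s (k - l) := by
  simp only [qchoose_eq_choose]
  rw [Ring.add_choose_eq k (Commute.all r s), Finset.Nat.sum_antidiagonal_eq_sum_range_succ_mk]

theorem neg_one_pow_mul_qchoose (z : ℚ) (k : ℕ) :
    (-1) ^ k * qchoose z k = qchoose (k - 1 - z) k := by
  have h := Ring.choose_neg (z - k + 1) k
  rw [show -(z - k + 1) = k - 1 - z by ring, show z - k + 1 + k - 1 = z by ring] at h
  rw [qchoose_eq_choose, qchoose_eq_choose, h]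
  rcases Nat.even_or_odd k with hk | hk
  · simp [Int.negOnePow_even k (by exact_mod_cast hk), hk.neg_one_pow]
  · simp [Int.negOnePow_odd k (by exact_mod_cast hk), hk.neg_one_pow]

theorem qchoose_mul_qchoose_sub (u : ℚ) {l s : ℕ} (h : s ≤ l) :
    qchoose u l * qchoose l (l - s) = qchoose u s * qchoose (u - s) (l - s) := by
  simp only [qchoose_eq_choose]
  rw [← Ring.choose_smul_choose u h, Ring.choose_natCast, Nat.choose_symm h, nsmul_eq_mul, mul_comm]

theorem sum_neg_one_pow_mul_qchoose (w y : ℚ) (q : ℕ) :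
    ∑ t ∈ Finset.range (q + 1), (-1) ^ (q - t) * qchoose (w + y - t) (q - t) * qchoose w t
      = (-1) ^ q * qchoose y q := by
  rw [neg_one_pow_mul_qchoose, show (q : ℚ) - 1 - y = w + (q - 1 - w - y) by ring, qchoose_add]
  refine Finset.sum_congr rfl fun t ht => ?_
  have htq : t ≤ q := by simpa [Nat.lt_succ_iff] using ht
  rw [neg_one_pow_mul_qchoose, Nat.cast_sub htq, mul_comm]
  congr 2
  ring

/-- Expansion of the Eberlein polynomial in a basis on which its difference operator in `y` is
bidiagonal. -/
theorem Eber_eq_sum (j : ℕ) (y a b : ℚ) :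
    Eber j y (a + b) a = ∑ l ∈ Finset.range (j + 1),
      (-1) ^ (j - l) * qchoose (a - l) (j - l) * (qchoose (a - y) l * qchoose (b - y + l) l) := by
  have hterm : ∀ l : ℕ, qchoose (a - y) l * qchoose (b - y + l) l =
      ∑ s ∈ Finset.range (l + 1),
        qchoose (b - y) s * (qchoose (a - y) s * qchoose (a - y - s) (l - s)) := by
    intro l
    rw [qchoose_add, Finset.mul_sum]
    refine Finset.sum_congr rfl fun s hs => ?_
    rw [← qchoose_mul_qchoose_sub _ (Nat.lt_succ_iff.mp (Finset.mem_range.mp hs))]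
    ring
  simp only [hterm, Finset.mul_sum]
  rw [Finset.sum_comm' (s' := fun s => Finset.Ico s (j + 1)) (t' := Finset.range (j + 1))
    (by simp only [Finset.mem_range, Finset.mem_Ico]; omega), Eber,
    ← Finset.sum_range_reflect]
  refine Finset.sum_congr rfl fun s hs => ?_
  have hsj : s ≤ j := Nat.lt_succ_iff.mp (Finset.mem_range.mp hs)
  rw [Finset.sum_Ico_eq_sum_range, show j + 1 - 1 - s = j - s by omega,
    show j + 1 - s = j - s + 1 by omega, show j - (j - s) = s by omega,
    ← sum_neg_one_pow_mul_qchoose (a - y - s) y (j - s), Finset.sum_mul, Finset.sum_mul]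
  refine Finset.sum_congr rfl fun t _ => ?_
  rw [show j - (s + t) = j - s - t by omega, show s + t - s = t by omega,
    show a - ((s + t : ℕ) : ℚ) = a - y - s + y - t by push_cast; ring,
    show a + b - a - y = b - y by ring]
  ring

theorem qchoose_mul_shift_up (a b y : ℚ) (l : ℕ) :
    (y - a) * (y - b) * (qchoose (a - (y + 1)) (l + 1)
        * qchoose (b - (y + 1) + ((l + 1 : ℕ) : ℚ)) (l + 1)) * (l + 1) ^ 2
      = (b - y) ^ 2 * (a - y - l - 1) * (a - y - l)
        * (qchoose (a - y) l * qchoose (b - y + l) l) := by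
  have hp : (a - y) * qchoose (a - (y + 1)) (l + 1) * (l + 1)
      = (a - y - l - 1) * (a - y - l) * qchoose (a - y) l := by
    have h := qchoose_succ_mul (a - y) (l + 1)
    rw [qchoose_succ_mul'] at h
    rw [← sub_sub, h, mul_right_comm, qchoose_succ_mul]
    push_cast
    ring
  have hq : qchoose (b - (y + 1) + ((l + 1 : ℕ) : ℚ)) (l + 1) * (l + 1)
      = (b - y) * qchoose (b - y + l) l := by
    rw [show b - (y + 1) + ((l + 1 : ℕ) : ℚ) = b - y + l by push_cast; ring,
      qchoose_succ_mul, add_sub_cancel_right, mul_comm]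
  linear_combination (b - y) * (l + 1) * qchoose (b - (y + 1) + ((l + 1 : ℕ) : ℚ)) (l + 1) * hp
    + (b - y) * (a - y - l - 1) * (a - y - l) * qchoose (a - y) l * hq

theorem qchoose_mul_shift_down (a b y : ℚ) (l : ℕ) :
    (y - a - 1) * (y - b - 1) * (qchoose (a - (y - 1)) (l + 1)
        * qchoose (b - (y - 1) + ((l + 1 : ℕ) : ℚ)) (l + 1)) * (l + 1) ^ 2
      = (a - y + 1) ^ 2 * (b - y + l + 2) * (b - y + l + 1)
        * (qchoose (a - y) l * qchoose (b - y + l) l) := by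
  have hp : qchoose (a - (y - 1)) (l + 1) * (l + 1) = (a - y + 1) * qchoose (a - y) l := by
    rw [qchoose_succ_mul', show a - (y - 1) - 1 = a - y by ring]
    ring
  have hq : (b - y + 1) * qchoose (b - (y - 1) + ((l + 1 : ℕ) : ℚ)) (l + 1) * (l + 1)
      = (b - y + l + 2) * (b - y + l + 1) * qchoose (b - y + l) l := by
    have h := qchoose_succ_mul (b - y + l + 2) (l + 1)
    have h' := qchoose_succ_mul' (b - y + l + 1) l
    rw [add_sub_cancel_right] at h'
    rw [qchoose_succ_mul', show b - y + l + 2 - 1 = b - y + l + 1 by ring] at h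
    rw [show b - (y - 1) + ((l + 1 : ℕ) : ℚ) = b - y + l + 2 by push_cast; ring]
    push_cast at h
    linear_combination (b - y + l + 2) * h' - (l + 1) * h
  linear_combination
    (a - y + 1) * (b - y + 1) * (l + 1) * qchoose (b - (y - 1) + ((l + 1 : ℕ) : ℚ)) (l + 1) * hp
    + (a - y + 1) ^ 2 * qchoose (a - y) l * hq

theorem difference_coefficient_identity (a b y l : ℚ) (h0 : 2 * y - a - b ≠ 0)
    (h1 : 2 * y - a - b - 1 ≠ 0) (h2 : 2 * y - a - b - 2 ≠ 0) :
    (y - a - b - 1) / ((2 * y - a - b) * (2 * y - a - b - 1))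
        * ((b - y) ^ 2 * (a - y - l - 1) * (a - y - l)
          - (y - a) * (y - b) * ((a - y - l) * (b - y + l + 1)))
      - y / ((2 * y - a - b - 1) * (2 * y - a - b - 2))
        * ((a - y + 1) ^ 2 * (b - y + l + 2) * (b - y + l + 1)
          - (y - a - 1) * (y - b - 1) * ((a - y - l) * (b - y + l + 1)))
    = (l + 1) * ((a - y - l) * (b - y + l + 1)) - (a - l) * (l + 1) ^ 2 := by
  obtain ⟨s, rfl⟩ : ∃ s, b = 2 * y - a - s := ⟨2 * y - a - b, by ring⟩
  have hs : 2 * y - a - (2 * y - a - s) = s := by ring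
  rw [hs] at h0 h1 h2 ⊢
  field_simp
  ring

/-- The difference operator in `y` acts bidiagonally on `C(a - y, l) C(b - y + l, l)`. -/
theorem qchoose_mul_difference (a b y : ℚ) (h0 : 2 * y - a - b ≠ 0) (h1 : 2 * y - a - b - 1 ≠ 0)
    (h2 : 2 * y - a - b - 2 ≠ 0) (B D : ℚ)
    (hB : B = (y - a) * (y - a - b - 1) * (y - b) / ((2 * y - a - b) * (2 * y - a - b - 1)))
    (hD : D = -(y * (y - a - 1) * (y - b - 1) / ((2 * y - a - b - 1) * (2 * y - a - b - 2))))
    (F : ℕ → ℚ → ℚ) (hF : ∀ l z, F l z = qchoose (a - z) l * qchoose (b - z + l) l) (l : ℕ) :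
    B * F (l + 1) (y + 1) - (B + D) * F (l + 1) y + D * F (l + 1) (y - 1)
      = (l + 1) * F (l + 1) y - (a - l) * F l y := by
  have hl : ((l : ℚ) + 1) ^ 2 ≠ 0 := by positivity
  have hup := qchoose_mul_shift_up a b y l
  have hdown := qchoose_mul_shift_down a b y l
  have hid := difference_coefficient_identity a b y l h0 h1 h2
  have hmid : F (l + 1) y * (l + 1) ^ 2 = (a - y - l) * (b - y + l + 1) * F l y := by
    have hp := qchoose_succ_mul (a - y) l
    have hq := qchoose_succ_mul' (b - y + l + 1) l
    rw [add_sub_cancel_right] at hq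
    rw [hF, hF, show b - y + ((l + 1 : ℕ) : ℚ) = b - y + l + 1 by push_cast; ring]
    linear_combination (l + 1) * qchoose (b - y + l + 1) (l + 1) * hp
      + (a - y - l) * qchoose (a - y) l * hq
  rw [← hF, ← hF] at hup hdown
  obtain ⟨c, hc⟩ : ∃ c, c = (y - a - b - 1) / ((2 * y - a - b) * (2 * y - a - b - 1)) := ⟨_, rfl⟩
  obtain ⟨d, hd⟩ : ∃ d, d = y / ((2 * y - a - b - 1) * (2 * y - a - b - 2)) := ⟨_, rfl⟩
  have hB' : B = (y - a) * (y - b) * c := by rw [hB, hc]; ring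
  have hD' : D = -((y - a - 1) * (y - b - 1) * d) := by rw [hD, hd]; ring
  rw [← hc, ← hd] at hid
  apply mul_right_cancel₀ hl
  rw [hB', hD']
  linear_combination c * hup - d * hdown + F l y * hid
    - ((y - a) * (y - b) * c - (y - a - 1) * (y - b - 1) * d + l + 1) * hmid

/-- The difference relation for Eberlein polynomials. -/
theorem Eber_difference (j : ℕ) (a b y : ℚ) (h0 : 2 * y - a - b ≠ 0)
    (h1 : 2 * y - a - b - 1 ≠ 0) (h2 : 2 * y - a - b - 2 ≠ 0) (B D : ℚ)
    (hB : B = (y - a) * (y - a - b - 1) * (y - b) / ((2 * y - a - b) * (2 * y - a - b - 1)))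
    (hD : D = -(y * (y - a - 1) * (y - b - 1) / ((2 * y - a - b - 1) * (2 * y - a - b - 2)))) :
    (j : ℚ) * Eber j y (a + b) a = B * Eber j (y + 1) (a + b) a
      - (B + D) * Eber j y (a + b) a + D * Eber j (y - 1) (a + b) a := by
  obtain ⟨F, hF⟩ : ∃ F : ℕ → ℚ → ℚ, ∀ l z, F l z = qchoose (a - z) l * qchoose (b - z + l) l :=
    ⟨_, fun _ _ => rfl⟩
  have key := qchoose_mul_difference a b y h0 h1 h2 B D hB hD F hF
  obtain ⟨c, hc⟩ : ∃ c : ℕ → ℚ, ∀ l, c l = (-1) ^ (j - l) * qchoose (a - l) (j - l) :=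
    ⟨_, fun _ => rfl⟩
  have hE : ∀ z, Eber j z (a + b) a = ∑ l ∈ Finset.range (j + 1), c l * F l z := fun z => by
    simp only [Eber_eq_sum, hc, hF]
  have hrec : ∀ l, l + 1 ≤ j → ((j : ℚ) - l) * c l = -(a - l) * c (l + 1) := by
    intro l hl
    obtain ⟨d, rfl⟩ := Nat.exists_eq_add_of_le hl
    have h := qchoose_succ_mul' (a - l) d
    rw [hc, hc, show l + 1 + d - l = d + 1 by omega, show l + 1 + d - (l + 1) = d by omega]
    push_cast
    rw [← sub_sub]
    linear_combination (-1) ^ (d + 1) * h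
  have hpartial : ∀ m, m ≤ j → ∑ l ∈ Finset.range (m + 1),
      c l * (B * F l (y + 1) - (B + D) * F l y + D * F l (y - 1) - j * F l y)
        = -((j : ℚ) - m) * c m * F m y := by
    intro m
    induction m with
    | zero =>
      intro _
      simp [hF, qchoose_zero]
      ring
    | succ m ih =>
      intro hm
      rw [Finset.sum_range_succ, ih (by omega), key m]
      push_cast
      linear_combination -F m y * hrec m hm
  have htotal := hpartial j le_rfl
  rw [sub_self, neg_zero, zero_mul, zero_mul] at htotal
  simp only [hE]
  rw [← sub_eq_zero, ← neg_eq_zero, ← htotal]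
  simp only [Finset.mul_sum, ← Finset.sum_sub_distrib, ← Finset.sum_add_distrib,
    ← Finset.sum_neg_distrib]
  exact Finset.sum_congr rfl fun l _ => by ring

/-- Difference relation in the second variable for the eigenvalues of the
non-binary Johnson scheme. -/
theorem peig_difference_second (r n k : ℤ) (hr : 3 ≤ r) (hk1 : 1 ≤ k) (hkn : k ≤ n - 1)
    (i j : ℕ) (hij : (i : ℤ) + j ≤ k) (hj : (j : ℤ) ≤ n - k)
    (x y : ℤ) (hx : 0 ≤ x) (hy : 0 ≤ y) (hxy : x + y ≤ k) (hyk : y ≤ n - k)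
    (h0 : 2 * y + x - n ≠ 0) (h1 : 2 * y + x - n ≠ 1) (h2 : 2 * y + x - n ≠ 2)
    (B D : ℚ)
    (hB : B = ((y : ℚ) + x - k) * ((y : ℚ) + x - n - 1) * ((y : ℚ) + k - n)
        / ((2 * (y : ℚ) + x - n) * (2 * (y : ℚ) + x - n - 1)))
    (hD : D = -((y : ℚ) * ((y : ℚ) + x - k - 1) * ((y : ℚ) + k - n - 1)
        / ((2 * (y : ℚ) + x - n - 1) * (2 * (y : ℚ) + x - n - 2)))) :
    (j : ℚ) * peig r n k i j x y
  = B * peig r n k i j x ((y : ℚ) + 1) - (B + D) * peig r n k i j x y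
    + D * peig r n k i j x ((y : ℚ) - 1) := by
  have e0 : 2 * (y : ℚ) + x - n ≠ 0 := by exact_mod_cast h0
  have e1 : 2 * (y : ℚ) + x - n - 1 ≠ 0 := sub_ne_zero.mpr (by exact_mod_cast h1)
  have e2 : 2 * (y : ℚ) + x - n - 2 ≠ 0 := sub_ne_zero.mpr (by exact_mod_cast h2)
  have s : 2 * (y : ℚ) - (k - x) - (n - k) = 2 * y + x - n := by ring
  have h := Eber_difference j ((k : ℚ) - x) ((n : ℚ) - k) y (by rwa [s]) (by rwa [s]) (by rwa [s])
    B D (by rw [hB, s]; congr 1; ring) (by rw [hD, s]; congr 2; ring)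
  rw [show (k : ℚ) - x + (n - k) = n - x by ring] at h
  simp only [peig]
  linear_combination ((r : ℚ) - 1) ^ j * Kraw i x ((k : ℚ) - j) ((r : ℚ) - 1) * h
end

section
/- The adjacency matrices of the non-binary Johnson scheme satisfy, for every (i,j) ∈ ℕ², the product relation A_{01}·A_{ij} = (k−i−j+1)(r−2)j·A_{i−1,j} + (k−i−j+1)(n−k−j+1)(r−1)·A_{i,j−1} + (i+1)j·A_{i+1,j} + (j+1)²·A_{i,j+1} + (i+1)(n−k−j+1)(r−1)·A_{i+1,j−1} + (j+1)²(r−2)·A_{i−1,j+1} + j(k−i−j+(r−2)i+(n−k−j)(r−1))·A_{ij}, where A_{a,b} := 0 whenever a < 0 or b < 0. -/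
/-- The vertex set of the non-binary Johnson scheme `J_r(k, n)`: words of length `n`
over the alphabet `{0, 1, …, r-1}` of weight `k` (number of nonzero letters). -/
abbrev JohnsonVertex (r n k : ℕ) :=
  {x : Fin n → Fin r // (Finset.univ.filter fun i => (x i).val ≠ 0).card = k}

/-- Number of equal nonzero components `e(x, y)`. -/
def ecnt {r n : ℕ} (x y : Fin n → Fin r) : ℕ :=
  (Finset.univ.filter fun i => x i = y i ∧ (x i).val ≠ 0).card

/-- Number of common nonzeros `c(x, y)`. -/
def ccnt {r n : ℕ} (x y : Fin n → Fin r) : ℕ :=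
  (Finset.univ.filter fun i => (x i).val ≠ 0 ∧ (y i).val ≠ 0).card

/-- Adjacency matrix `A_{ij}` of the non-binary Johnson scheme `J_r(k, n)`,
with the convention `A_{ij} := 0` whenever `i < 0` or `j < 0`. -/
def Amat (r n k : ℕ) (i j : ℤ) : Matrix (JohnsonVertex r n k) (JohnsonVertex r n k) ℚ :=
  if i < 0 ∨ j < 0 then 0 else
    Matrix.of fun x y =>
      if (ecnt x.1 y.1 : ℤ) = (k : ℤ) - i - j ∧ (ccnt x.1 y.1 : ℤ) = (k : ℤ) - j then 1 else 0

/-- The word obtained from `x` by erasing the letter in position `p` and writing `v`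
in position `q`. -/
def moveLetter {r n : ℕ} [NeZero r] (x : Fin n → Fin r) (p q : Fin n) (v : Fin r) :
    Fin n → Fin r :=
  Function.update (Function.update x p 0) q v

theorem Amat_apply {r n k : ℕ} (i j : ℤ) (x y : JohnsonVertex r n k) :
    Amat r n k i j x y =
      if (ecnt x.1 y.1 : ℤ) = (k : ℤ) - i - j ∧ (ccnt x.1 y.1 : ℤ) = (k : ℤ) - j
        then 1 else 0 := by
  have hec : ecnt x.1 y.1 ≤ ccnt x.1 y.1 := by
    refine Finset.card_le_card fun t ht => ?_
    simp only [Finset.mem_filter, Finset.mem_univ, true_and] at ht ⊢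
    exact ⟨ht.2, ht.1 ▸ ht.2⟩
  have hck : ccnt x.1 y.1 ≤ k := by
    refine le_of_le_of_eq (Finset.card_le_card fun t ht => ?_) x.2
    simp only [Finset.mem_filter, Finset.mem_univ, true_and] at ht ⊢
    exact ht.1
  unfold Amat
  split_ifs with h1 h2
  · omega
  · rfl
  · simp [*]
  · simp [*]

theorem card_filter_update {ι α : Type*} [Fintype ι] [DecidableEq ι] (P : ι → α → Prop)
    [∀ i a, Decidable (P i a)] (z : ι → α) (q : ι) (v : α) :
    ((Finset.univ.filter fun i => P i (Function.update z q v i)).card : ℤ) =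
      (Finset.univ.filter fun i => P i (z i)).card
        - (if P q (z q) then 1 else 0) + (if P q v then 1 else 0) := by
  simp only [Finset.card_filter, Nat.cast_sum]
  rw [← Finset.add_sum_erase _ _ (Finset.mem_univ q),
    ← Finset.add_sum_erase (a := q) (f := fun i => ((if P i (z i) then 1 else 0 : ℕ) : ℤ)) _
      (Finset.mem_univ q)]
  rw [Finset.sum_congr rfl (g := fun i => ((if P i (z i) then 1 else 0 : ℕ) : ℤ))
    (s₂ := Finset.univ.erase q)
    (fun i hi => by rw [Function.update_of_ne (Finset.ne_of_mem_erase hi)])]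
  rw [Function.update_self]
  push_cast
  ring

theorem card_filter_moveLetter {r n : ℕ} [NeZero r] (P : Fin n → Fin r → Prop)
    [∀ i a, Decidable (P i a)] {x : Fin n → Fin r} {p q : Fin n} (hp : x p ≠ 0) (hq : x q = 0)
    (v : Fin r) :
    ((Finset.univ.filter fun i => P i (moveLetter x p q v i)).card : ℤ) =
      (Finset.univ.filter fun i => P i (x i)).card
        - (if P p (x p) then 1 else 0) + (if P p 0 then 1 else 0)
        - (if P q 0 then 1 else 0) + (if P q v then 1 else 0) := by
  have hqp : q ≠ p := by rintro rfl; exact hp hq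
  unfold moveLetter
  rw [card_filter_update P, card_filter_update P, Function.update_of_ne hqp, hq]

section Counts

variable {r n : ℕ} [NeZero r] {x y : Fin n → Fin r} {p q : Fin n} {v : Fin r}

theorem weight_moveLetter (hp : x p ≠ 0) (hq : x q = 0) (hv : v ≠ 0) :
    (Finset.univ.filter fun i => (moveLetter x p q v i).val ≠ 0).card =
      (Finset.univ.filter fun i => (x i).val ≠ 0).card := by
  have h := card_filter_moveLetter (fun _ a => a.val ≠ 0) hp hq v
  simp only [Fin.val_ne_zero_iff, ne_eq, hp, hv, not_true_eq_false, not_false_eq_true, if_true,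
    if_false, add_zero, sub_zero, sub_add_cancel] at h ⊢
  exact_mod_cast h

theorem ecnt_self_moveLetter (hp : x p ≠ 0) (hq : x q = 0) :
    (ecnt x (moveLetter x p q v) : ℤ) =
      (Finset.univ.filter fun i => (x i).val ≠ 0).card - 1 := by
  have h := card_filter_moveLetter (fun i a => x i = a ∧ (x i).val ≠ 0) hp hq v
  unfold ecnt
  rw [h]
  simp [Fin.val_eq_zero_iff, hp, hq]

theorem ccnt_self_moveLetter (hp : x p ≠ 0) (hq : x q = 0) :
    (ccnt x (moveLetter x p q v) : ℤ) =
      (Finset.univ.filter fun i => (x i).val ≠ 0).card - 1 := by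
  have h := card_filter_moveLetter (fun i a => (x i).val ≠ 0 ∧ a.val ≠ 0) hp hq v
  unfold ccnt
  rw [h]
  simp [Fin.val_eq_zero_iff, hp, hq]

theorem ecnt_moveLetter (hp : x p ≠ 0) (hq : x q = 0) (hv : v ≠ 0) :
    (ecnt (moveLetter x p q v) y : ℤ) =
      ecnt x y - (if x p = y p then 1 else 0) + (if v = y q then 1 else 0) := by
  have h := card_filter_moveLetter (fun i a => a = y i ∧ a.val ≠ 0) hp hq v
  unfold ecnt
  rw [h]
  simp [Fin.val_eq_zero_iff, hp, hv]

theorem ccnt_moveLetter (hp : x p ≠ 0) (hq : x q = 0) (hv : v ≠ 0) :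
    (ccnt (moveLetter x p q v) y : ℤ) =
      ccnt x y - (if y p ≠ 0 then 1 else 0) + (if y q ≠ 0 then 1 else 0) := by
  have h := card_filter_moveLetter (fun i a => a.val ≠ 0 ∧ (y i).val ≠ 0) hp hq v
  unfold ccnt
  rw [h]
  simp [Fin.val_eq_zero_iff, hp, hv]

theorem moveLetter_inj {p' q' : Fin n} {v' : Fin r} (hp : x p ≠ 0) (hq : x q = 0) (hv : v ≠ 0)
    (hq' : x q' = 0)
    (h : moveLetter x p q v = moveLetter x p' q' v') : p = p' ∧ q = q' ∧ v = v' := by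
  have h1 := congrFun h p
  have h2 := congrFun h q
  simp only [moveLetter, Function.update_apply] at h1 h2
  grind

theorem exists_eq_moveLetter {z : Fin n → Fin r}
    (hw : (Finset.univ.filter fun i => (z i).val ≠ 0).card =
      (Finset.univ.filter fun i => (x i).val ≠ 0).card)
    (he : (ecnt x z : ℤ) = (Finset.univ.filter fun i => (x i).val ≠ 0).card - 1)
    (hc : (ccnt x z : ℤ) = (Finset.univ.filter fun i => (x i).val ≠ 0).card - 1) :
    ∃ p q v, x p ≠ 0 ∧ x q = 0 ∧ v ≠ 0 ∧ moveLetter x p q v = z := by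
  simp only [ecnt, ccnt, Fin.val_ne_zero_iff] at hw he hc
  have hsub : (Finset.univ.filter fun i => x i = z i ∧ x i ≠ 0) ⊆
      Finset.univ.filter fun i => x i ≠ 0 ∧ z i ≠ 0 := by
    intro i; simp only [Finset.mem_filter]; grind
  have heq := Finset.eq_of_subset_of_card_le hsub (by omega)
  have hagree : ∀ i, x i ≠ 0 → z i ≠ 0 → x i = z i := by
    intro i h1 h2
    have : i ∈ Finset.univ.filter fun i => x i ≠ 0 ∧ z i ≠ 0 := by simp [h1, h2]
    rw [← heq] at this
    simp at this
    exact this.1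
  have hxz := Finset.card_filter_add_card_filter_not
    (s := Finset.univ.filter fun i => x i ≠ 0) (fun i => z i ≠ 0)
  have hzx := Finset.card_filter_add_card_filter_not
    (s := Finset.univ.filter fun i => z i ≠ 0) (fun i => x i ≠ 0)
  simp only [Finset.filter_filter, not_not] at hxz hzx
  simp only [and_comm (a := z _ ≠ 0) (b := x _ ≠ 0)] at hzx
  obtain ⟨p, hp⟩ := Finset.card_eq_one.1
    (show (Finset.univ.filter fun i => x i ≠ 0 ∧ z i = 0).card = 1 by omega)
  obtain ⟨q, hq⟩ := Finset.card_eq_one.1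
    (show (Finset.univ.filter fun i => z i ≠ 0 ∧ x i = 0).card = 1 by omega)
  simp only [Finset.ext_iff, Finset.mem_filter, Finset.mem_univ, true_and,
    Finset.mem_singleton] at hp hq
  refine ⟨p, q, z q, ((hp p).2 rfl).1, ((hq q).2 rfl).2, ((hq q).2 rfl).1, funext fun i => ?_⟩
  simp only [moveLetter, Function.update_apply]
  grind

theorem sum_filter_ne_zero_eq (g : ℤ → ℤ → ℚ) :
    ∑ p with x p ≠ 0, g (if x p = y p then 1 else 0) (if y p ≠ 0 then 1 else 0) =
      (ecnt x y : ℚ) * g 1 1 + ((ccnt x y : ℚ) - ecnt x y) * g 0 1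
        + (((Finset.univ.filter fun i => (x i).val ≠ 0).card : ℚ) - ccnt x y) * g 0 0 := by
  simp only [ecnt, ccnt, Finset.card_filter, Nat.cast_sum, ← Finset.sum_sub_distrib,
    Finset.sum_mul, ← Finset.sum_add_distrib, Finset.sum_filter, Fin.val_ne_zero_iff]
  refine Finset.sum_congr rfl fun p _ => ?_
  by_cases hx : x p = 0 <;> by_cases hy : y p = 0 <;> by_cases hxy : x p = y p <;> simp_all

theorem sum_letters_ne_zero (g : ℤ → ℚ) (a : Fin r) :
    ∑ v with v ≠ 0, g (if v = a then 1 else 0) =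
      if a ≠ 0 then g 1 + ((r : ℚ) - 2) * g 0 else ((r : ℚ) - 1) * g 0 := by
  have h : ∀ v : Fin r, (if v ≠ 0 then g (if v = a then 1 else 0) else 0) =
      g 0 + (if v = a then (if a ≠ 0 then g 1 - g 0 else 0) else 0)
        - (if v = 0 then g 0 else 0) := by
    intro v
    by_cases hv : v = 0 <;> by_cases hva : v = a <;> simp_all
  rw [Finset.sum_filter, Finset.sum_congr rfl fun v _ => h v]
  simp only [Finset.sum_sub_distrib, Finset.sum_add_distrib, Finset.sum_ite_eq',
    Finset.mem_univ, if_true, Finset.sum_const, Finset.card_univ, Fintype.card_fin, nsmul_eq_mul]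
  split_ifs <;> ring

theorem sum_filter_zero_letters (g : ℤ → ℤ → ℚ) :
    ∑ q with x q = 0, ∑ v with v ≠ 0,
        g (if v = y q then 1 else 0) (if y q ≠ 0 then 1 else 0) =
      (((Finset.univ.filter fun i => (y i).val ≠ 0).card : ℚ) - ccnt x y)
          * (g 1 1 + ((r : ℚ) - 2) * g 0 1)
        + ((n : ℚ) - (Finset.univ.filter fun i => (x i).val ≠ 0).card
            - (Finset.univ.filter fun i => (y i).val ≠ 0).card + ccnt x y)
          * (((r : ℚ) - 1) * g 0 0) := by
  have hn : (n : ℚ) = ∑ _i : Fin n, 1 := by simp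
  simp only [fun q => sum_letters_ne_zero
    (fun t => g t (if y q ≠ 0 then 1 else 0)) (y q)]
  rw [hn]
  simp only [ccnt, Finset.card_filter, Nat.cast_sum, ← Finset.sum_sub_distrib,
    Finset.sum_mul, ← Finset.sum_add_distrib, Finset.sum_filter, Fin.val_ne_zero_iff]
  refine Finset.sum_congr rfl fun q _ => ?_
  by_cases hx : x q = 0 <;> by_cases hy : y q = 0 <;> simp_all

theorem sum_moves (F : ℤ → ℤ → ℚ) {k : ℕ}
    (hx : (Finset.univ.filter fun i => (x i).val ≠ 0).card = k)
    (hy : (Finset.univ.filter fun i => (y i).val ≠ 0).card = k) :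
    ∑ p with x p ≠ 0, ∑ q with x q = 0, ∑ v with v ≠ 0,
        F (ecnt x y - (if x p = y p then 1 else 0) + (if v = y q then 1 else 0))
          (ccnt x y - (if y p ≠ 0 then 1 else 0) + (if y q ≠ 0 then 1 else 0)) =
      (ecnt x y : ℚ) *
        (((k : ℚ) - ccnt x y) * (F (ecnt x y) (ccnt x y)
            + ((r : ℚ) - 2) * F (ecnt x y - 1) (ccnt x y))
          + ((n : ℚ) - k - k + ccnt x y) * (((r : ℚ) - 1) * F (ecnt x y - 1) (ccnt x y - 1)))
      + ((ccnt x y : ℚ) - ecnt x y) *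
        (((k : ℚ) - ccnt x y) * (F (ecnt x y + 1) (ccnt x y)
            + ((r : ℚ) - 2) * F (ecnt x y) (ccnt x y))
          + ((n : ℚ) - k - k + ccnt x y) * (((r : ℚ) - 1) * F (ecnt x y) (ccnt x y - 1)))
      + ((k : ℚ) - ccnt x y) *
        (((k : ℚ) - ccnt x y) * (F (ecnt x y + 1) (ccnt x y + 1)
            + ((r : ℚ) - 2) * F (ecnt x y) (ccnt x y + 1))
          + ((n : ℚ) - k - k + ccnt x y) * (((r : ℚ) - 1) * F (ecnt x y) (ccnt x y))) := by
  refine (Finset.sum_congr rfl fun p _ => sum_filter_zero_letters (x := x) (y := y) fun s t =>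
    F (ecnt x y - (if x p = y p then 1 else 0) + s)
      (ccnt x y - (if y p ≠ 0 then 1 else 0) + t)).trans ?_
  refine (sum_filter_ne_zero_eq (x := x) (y := y) fun s t =>
    ((((Finset.univ.filter fun i => (y i).val ≠ 0).card : ℚ) - ccnt x y)
          * (F (ecnt x y - s + 1) (ccnt x y - t + 1)
            + ((r : ℚ) - 2) * F (ecnt x y - s + 0) (ccnt x y - t + 1))
        + ((n : ℚ) - (Finset.univ.filter fun i => (x i).val ≠ 0).card
            - (Finset.univ.filter fun i => (y i).val ≠ 0).card + ccnt x y)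
          * (((r : ℚ) - 1) * F (ecnt x y - s + 0) (ccnt x y - t + 0)))).trans ?_
  simp only [hx, hy, sub_zero, add_zero, sub_add_cancel]

end Counts

theorem Amat_zero_one_mul_apply {r n k : ℕ} [NeZero r] (i j : ℤ) (x y : JohnsonVertex r n k) :
    (Amat r n k 0 1 * Amat r n k i j) x y =
      ∑ p with x.1 p ≠ 0, ∑ q with x.1 q = 0, ∑ v with v ≠ 0,
        if (ecnt x.1 y.1 : ℤ) - (if x.1 p = y.1 p then 1 else 0)
              + (if v = y.1 q then 1 else 0) = k - i - j ∧
            (ccnt x.1 y.1 : ℤ) - (if y.1 p ≠ 0 then 1 else 0)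
              + (if y.1 q ≠ 0 then 1 else 0) = k - j
          then (1 : ℚ) else 0 := by
  simp only [← Finset.sum_product']
  simp only [Matrix.mul_apply, Amat_apply, sub_zero, ite_mul, one_mul, zero_mul]
  rw [← Finset.sum_filter]
  symm
  refine Finset.sum_bij
    (fun t ht => ⟨moveLetter x.1 t.1 t.2.1 t.2.2, ?_⟩) ?_ ?_ ?_ ?_
  · simp only [Finset.mem_product, Finset.mem_filter, Finset.mem_univ, true_and] at ht
    exact (weight_moveLetter ht.1 ht.2.1 ht.2.2).trans x.2
  · intro t ht
    simp only [Finset.mem_product, Finset.mem_filter, Finset.mem_univ, true_and] at ht ⊢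
    rw [ecnt_self_moveLetter ht.1 ht.2.1, ccnt_self_moveLetter ht.1 ht.2.1, x.2]
    exact ⟨rfl, rfl⟩
  · intro t ht t' ht' h
    simp only [Finset.mem_product, Finset.mem_filter, Finset.mem_univ, true_and] at ht ht'
    obtain ⟨h1, h2, h3⟩ := moveLetter_inj ht.1 ht.2.1 ht.2.2 ht'.2.1
      (congrArg Subtype.val h)
    exact Prod.ext h1 (Prod.ext h2 h3)
  · intro z hz
    simp only [Finset.mem_filter, Finset.mem_univ, true_and] at hz
    obtain ⟨p, q, v, hp, hq, hv, h⟩ := exists_eq_moveLetter (x := x.1) (z := z.1)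
      (z.2.trans x.2.symm) (by rw [x.2]; exact hz.1) (by rw [x.2]; exact hz.2)
    exact ⟨(p, q, v), by simp [hp, hq, hv], Subtype.ext h⟩
  · intro t ht
    simp only [Finset.mem_product, Finset.mem_filter, Finset.mem_univ, true_and] at ht
    simp only [ecnt_moveLetter ht.1 ht.2.1 ht.2.2, ccnt_moveLetter ht.1 ht.2.1 ht.2.2]

/-- Product relation `A_{01} A_{ij}` in the non-binary Johnson scheme. -/
theorem johnson_A01_product (r n k : ℕ) (hr : 3 ≤ r) (hn : 1 ≤ n) (hk : k ≤ n) (i j : ℕ) :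
    Amat r n k 0 1 * Amat r n k i j
  = (((k : ℚ) - i - j + 1) * ((r : ℚ) - 2) * j) • Amat r n k ((i : ℤ) - 1) j
    + (((k : ℚ) - i - j + 1) * ((n : ℚ) - k - j + 1) * ((r : ℚ) - 1)) • Amat r n k i ((j : ℤ) - 1)
    + (((i : ℚ) + 1) * j) • Amat r n k ((i : ℤ) + 1) j
    + (((j : ℚ) + 1) ^ 2) • Amat r n k i ((j : ℤ) + 1)
    + (((i : ℚ) + 1) * ((n : ℚ) - k - j + 1) * ((r : ℚ) - 1)) • Amat r n k ((i : ℤ) + 1) ((j : ℤ) - 1)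
    + (((j : ℚ) + 1) ^ 2 * ((r : ℚ) - 2)) • Amat r n k ((i : ℤ) - 1) ((j : ℤ) + 1)
    + ((j : ℚ) * ((k : ℚ) - i - j + ((r : ℚ) - 2) * i + ((n : ℚ) - k - j) * ((r : ℚ) - 1)))
        • Amat r n k i j := by
  have : NeZero r := ⟨by omega⟩
  ext x y
  rw [Amat_zero_one_mul_apply, sum_moves (fun s t : ℤ => if s = (k : ℤ) - i - j ∧
    t = (k : ℤ) - j then (1 : ℚ) else 0) x.2 y.2]
  simp only [Matrix.add_apply, Matrix.smul_apply, smul_eq_mul, Amat_apply]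
  generalize ecnt x.1 y.1 = e
  generalize ccnt x.1 y.1 = c
  have coeff : ∀ {P Q : Prop} [Decidable P] [Decidable Q] {a b : ℚ}, (P ↔ Q) → (Q → a = b) →
      a * (if P then 1 else 0) = b * (if Q then 1 else 0) := by
    intro P Q _ _ a b hPQ hab
    by_cases h : Q
    · rw [hab h, if_pos h, if_pos (hPQ.2 h)]
    · rw [if_neg h, if_neg (mt hPQ.1 h), mul_zero, mul_zero]
  have cast : ∀ {a b : ℤ}, (e : ℤ) = a ∧ (c : ℤ) = b → (e : ℚ) = a ∧ (c : ℚ) = b := by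
    rintro a b ⟨h₁, h₂⟩
    exact ⟨by exact_mod_cast h₁, by exact_mod_cast h₂⟩
  have h₁ : (e : ℚ) * (k - c) * (r - 2) *
      (if (e : ℤ) - 1 = k - i - j ∧ (c : ℤ) = k - j then 1 else 0) = _ :=
    coeff (Q := (e : ℤ) = k - (i - 1) - j ∧ (c : ℤ) = k - j)
      (b := ((k : ℚ) - i - j + 1) * (r - 2) * j) (by omega)
      fun h => by obtain ⟨h₁, h₂⟩ := cast h; rw [h₁, h₂]; push_cast; ring
  have h₂ : (e : ℚ) * (n - k - k + c) * (r - 1) *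
      (if (e : ℤ) - 1 = k - i - j ∧ (c : ℤ) - 1 = k - j then 1 else 0) = _ :=
    coeff (Q := (e : ℤ) = k - i - (j - 1) ∧ (c : ℤ) = k - (j - 1))
      (b := ((k : ℚ) - i - j + 1) * (n - k - j + 1) * (r - 1)) (by omega)
      fun h => by obtain ⟨h₁, h₂⟩ := cast h; rw [h₁, h₂]; push_cast; ring
  have h₃ : ((c : ℚ) - e) * (k - c) *
      (if (e : ℤ) + 1 = k - i - j ∧ (c : ℤ) = k - j then 1 else 0) = _ :=
    coeff (Q := (e : ℤ) = k - (i + 1) - j ∧ (c : ℤ) = k - j)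
      (b := ((i : ℚ) + 1) * j) (by omega)
      fun h => by obtain ⟨h₁, h₂⟩ := cast h; rw [h₁, h₂]; push_cast; ring
  have h₄ : ((k : ℚ) - c) * (k - c) *
      (if (e : ℤ) + 1 = k - i - j ∧ (c : ℤ) + 1 = k - j then 1 else 0) = _ :=
    coeff (Q := (e : ℤ) = k - i - (j + 1) ∧ (c : ℤ) = k - (j + 1))
      (b := ((j : ℚ) + 1) ^ 2) (by omega)
      fun h => by obtain ⟨h₁, h₂⟩ := cast h; rw [h₂]; push_cast; ring
  have h₅ : ((c : ℚ) - e) * (n - k - k + c) * (r - 1) *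
      (if (e : ℤ) = k - i - j ∧ (c : ℤ) - 1 = k - j then 1 else 0) = _ :=
    coeff (Q := (e : ℤ) = k - (i + 1) - (j - 1) ∧ (c : ℤ) = k - (j - 1))
      (b := ((i : ℚ) + 1) * (n - k - j + 1) * (r - 1)) (by omega)
      fun h => by obtain ⟨h₁, h₂⟩ := cast h; rw [h₁, h₂]; push_cast; ring
  have h₆ : ((k : ℚ) - c) * (k - c) * (r - 2) *
      (if (e : ℤ) = k - i - j ∧ (c : ℤ) + 1 = k - j then 1 else 0) = _ :=
    coeff (Q := (e : ℤ) = k - (i - 1) - (j + 1) ∧ (c : ℤ) = k - (j + 1))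
      (b := ((j : ℚ) + 1) ^ 2 * (r - 2)) (by omega)
      fun h => by obtain ⟨h₁, h₂⟩ := cast h; rw [h₂]; push_cast; ring
  have h₇ : ((e : ℚ) * (k - c) + (c - e) * (k - c) * (r - 2) +
        (k - c) * (n - k - k + c) * (r - 1)) *
      (if (e : ℤ) = k - i - j ∧ (c : ℤ) = k - j then 1 else 0) = _ :=
    coeff (Q := (e : ℤ) = k - i - j ∧ (c : ℤ) = k - j)
      (b := (j : ℚ) * ((k : ℚ) - i - j + (r - 2) * i + (n - k - j) * (r - 1))) Iff.rfl
      fun h => by obtain ⟨h₁, h₂⟩ := cast h; rw [h₁, h₂]; push_cast; ring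
  linear_combination h₁ + h₂ + h₃ + h₄ + h₅ + h₆ + h₇
end

section
/- In the subconstituent algebra of the non-binary Johnson scheme J_r(k,n), the pair (A*_{10}, A_{10}) satisfies the Dolan–Grady relation [A*_{10}, [A*_{10}, [A*_{10}, A_{10}]]] = (n(r−1)/k)²·[A*_{10}, A_{10}]. -/
/-- `θ*(a, b) = (n/k)((r-2)(k-b) - a(r-1))`. -/
noncomputable def thetaStar (r n k : ℕ) (a b : ℚ) : ℚ :=
  ((n : ℚ) / k) * (((r : ℚ) - 2) * ((k : ℚ) - b) - a * ((r : ℚ) - 1))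

/-- `μ*(a, b) = (n-1)(1 - n b / (k(n-k)))`. -/
noncomputable def muStar (n k : ℕ) (b : ℚ) : ℚ :=
  ((n : ℚ) - 1) * (1 - (n : ℚ) * b / ((k : ℚ) * ((n : ℚ) - k)))

/-- Dual adjacency matrix `A*_{10}` of the non-binary Johnson scheme with respect to `x0`. -/
noncomputable def Astar10 (r n k : ℕ) (x0 : JohnsonVertex r n k) :
    Matrix (JohnsonVertex r n k) (JohnsonVertex r n k) ℚ :=
  Matrix.diagonal fun y =>
    thetaStar r n k ((ccnt x0.1 y.1 : ℚ) - (ecnt x0.1 y.1 : ℚ)) ((k : ℚ) - (ccnt x0.1 y.1 : ℚ))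

/-- Dual adjacency matrix `A*_{01}` of the non-binary Johnson scheme with respect to `x0`. -/
noncomputable def Astar01 (r n k : ℕ) (x0 : JohnsonVertex r n k) :
    Matrix (JohnsonVertex r n k) (JohnsonVertex r n k) ℚ :=
  Matrix.diagonal fun y => muStar n k ((k : ℚ) - (ccnt x0.1 y.1 : ℚ))

/-- Matrix commutator. -/
def mcomm {m : Type*} [Fintype m] (A B : Matrix m m ℚ) : Matrix m m ℚ := A * B - B * A

theorem mcomm_diagonal_apply {m : Type*} [Fintype m] [DecidableEq m] (d : m → ℚ)
    (M : Matrix m m ℚ) (x y : m) :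
    mcomm (Matrix.diagonal d) M x y = (d x - d y) * M x y := by
  simp only [mcomm, Matrix.sub_apply, Matrix.diagonal_mul, Matrix.mul_diagonal]
  ring

theorem ecnt_comm {r n : ℕ} (x y : Fin n → Fin r) : ecnt x y = ecnt y x := by
  unfold ecnt
  congr 1
  ext i
  simp only [Finset.mem_filter, Finset.mem_univ, true_and]
  constructor <;> rintro ⟨h, h'⟩ <;> exact ⟨h.symm, h ▸ h'⟩

theorem ccnt_comm {r n : ℕ} (x y : Fin n → Fin r) : ccnt x y = ccnt y x := by
  simp only [ccnt, and_comm]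

/-- If every pair of nonzero letters is common, the support of `x` lies in that of `y`. -/
theorem ne_zero_of_ccnt_eq {r n k : ℕ} (x y : JohnsonVertex r n k) (h : ccnt x.1 y.1 = k)
    (i : Fin n) (hi : (x.1 i).val ≠ 0) : (y.1 i).val ≠ 0 := by
  have hsub : (Finset.univ.filter fun i => (x.1 i).val ≠ 0 ∧ (y.1 i).val ≠ 0) ⊆
      Finset.univ.filter fun i => (x.1 i).val ≠ 0 :=
    Finset.monotone_filter_right _ fun _ _ h => h.1
  have heq := Finset.eq_of_subset_of_card_le hsub (x.2.trans h.symm).le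
  have hmem : i ∈ Finset.univ.filter fun i => (x.1 i).val ≠ 0 := by simpa using hi
  rw [← heq] at hmem
  exact (Finset.mem_filter.1 hmem).2.2

theorem ccnt_eq_of_ccnt_eq {r n k : ℕ} (z : Fin n → Fin r) (x y : JohnsonVertex r n k)
    (h : ccnt x.1 y.1 = k) : ccnt z x.1 = ccnt z y.1 := by
  have hxy i : (x.1 i).val ≠ 0 ↔ (y.1 i).val ≠ 0 :=
    ⟨ne_zero_of_ccnt_eq x y h i, ne_zero_of_ccnt_eq y x ((ccnt_comm _ _).trans h) i⟩
  simp only [ccnt, hxy]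

/-- Agreement with a fixed word drops by at most the number of nonzero letters of `x`
that `y` does not share. -/
theorem ecnt_add_ecnt_le {r n k : ℕ} (z : Fin n → Fin r) (x y : JohnsonVertex r n k) :
    ecnt z x.1 + ecnt x.1 y.1 ≤ ecnt z y.1 + k := by
  have hinter : (Finset.univ.filter fun i => z i = x.1 i ∧ (z i).val ≠ 0) ∩
      (Finset.univ.filter fun i => x.1 i = y.1 i ∧ (x.1 i).val ≠ 0) ⊆
      Finset.univ.filter fun i => z i = y.1 i ∧ (z i).val ≠ 0 := by
    intro i hi
    simp only [Finset.mem_inter, Finset.mem_filter, Finset.mem_univ, true_and] at hi ⊢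
    exact ⟨hi.1.1.trans hi.2.1, hi.1.2⟩
  have hunion : (Finset.univ.filter fun i => z i = x.1 i ∧ (z i).val ≠ 0) ∪
      (Finset.univ.filter fun i => x.1 i = y.1 i ∧ (x.1 i).val ≠ 0) ⊆
      Finset.univ.filter fun i => (x.1 i).val ≠ 0 := by
    intro i hi
    simp only [Finset.mem_union, Finset.mem_filter, Finset.mem_univ, true_and] at hi ⊢
    rcases hi with hi | hi
    · exact hi.1 ▸ hi.2
    · exact hi.2
  have hsum := Finset.card_union_add_card_inter
    (Finset.univ.filter fun i => z i = x.1 i ∧ (z i).val ≠ 0)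
    (Finset.univ.filter fun i => x.1 i = y.1 i ∧ (x.1 i).val ≠ 0)
  have h₁ := Finset.card_le_card hinter
  have h₂ := (Finset.card_le_card hunion).trans_eq x.2
  unfold ecnt
  omega

/-- Dolan–Grady relation for the pair `(A*_{10}, A_{10})` in the subconstituent algebra
of the non-binary Johnson scheme. -/
theorem johnson_dolan_grady_dual (r n k : ℕ) (hr : 3 ≤ r) (hk1 : 1 ≤ k) (hkn : k + 1 ≤ n)
    (x0 : JohnsonVertex r n k) :
    mcomm (Astar10 r n k x0) (mcomm (Astar10 r n k x0)
        (mcomm (Astar10 r n k x0) (Amat r n k 1 0)))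
  = (((n : ℚ) * ((r : ℚ) - 1) / k) ^ 2) • mcomm (Astar10 r n k x0) (Amat r n k 1 0) := by
  ext x y
  simp only [Astar10, mcomm_diagonal_apply, Matrix.smul_apply, smul_eq_mul]
  by_cases hxy : (ecnt x.1 y.1 : ℤ) = (k : ℤ) - 1 - 0 ∧ (ccnt x.1 y.1 : ℤ) = (k : ℤ) - 0
  · obtain ⟨he, hc⟩ := hxy
    rw [ccnt_eq_of_ccnt_eq x0.1 x y (by omega)]
    have h₁ := ecnt_add_ecnt_le x0.1 x y
    have h₂ := ecnt_add_ecnt_le x0.1 y x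
    rw [ecnt_comm y.1 x.1] at h₂
    have hcube : ((ecnt x0.1 x.1 : ℚ) - ecnt x0.1 y.1) ^ 3 =
        (ecnt x0.1 x.1 : ℚ) - ecnt x0.1 y.1 := by
      obtain h | h | h : ecnt x0.1 x.1 = ecnt x0.1 y.1 ∨
          ecnt x0.1 x.1 = ecnt x0.1 y.1 + 1 ∨ ecnt x0.1 y.1 = ecnt x0.1 x.1 + 1 := by omega
      all_goals rw [h]; push_cast; ring
    unfold thetaStar
    linear_combination (((n : ℚ) * ((r : ℚ) - 1) / k) ^ 3 * Amat r n k 1 0 x y) * hcube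
  · have hA : Amat r n k 1 0 x y = 0 := by
      simp only [Amat, Matrix.of_apply, if_neg hxy, if_neg (by decide : ¬((1 : ℤ) < 0 ∨ (0 : ℤ) < 0))]
    simp only [hA, mul_zero]
end
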